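/- (Integrity under modification, Theorem 2.) Let h : β → α be an injective leaf-hash function and H : α → α → α a pairwise injective combiner. Let L and L' be nonempty lists of log entries of equal length that differ at some index i (L'[i] ≠ L[i]). Then the Merkle root of the leaf hashes of L' differs from the Merkle root of the leaf hashes of L: root(L'.map h) ≠ root(L.map h). Hence any alteration of a stored entry is detected by comparison against the anchored root. -/

import Mathlib

/-- Side of a sibling hash in an inclusion proof. -/
inductive Side
  | left
  | right
deriving DecidableEq, Repr

/-- One Merkle level step: combine consecutive pairs with `H`,
promoting an unpaired final element unchanged. -/
def levelStep {α : Type*} (H : α → α → α) : List α → List α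
  | a :: b :: rest => H a b :: levelStep H rest
  | l => l

theorem levelStep_length {α : Type*} (H : α → α → α) :
    (l : List α) → (levelStep H l).length = (l.length + 1) / 2
  | [] => by simp [levelStep]
  | [_] => by simp [levelStep]
  | a :: b :: rest => by
      simp only [levelStep, List.length_cons, levelStep_length H rest]
      omega

/-- The Merkle root of a list of leaf hashes (`none` on the empty list),
obtained by iterating the level step until a single hash remains. -/
def merkleRoot? {α : Type*} (H : α → α → α) : List α → Option α
  | [] => none
  | [a] => some a
  | a :: b :: rest => merkleRoot? H (levelStep H (a :: b :: rest))
termination_by l => l.length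
decreasing_by
  simp only [levelStep_length, List.length_cons]
  omega

theorem levelStep_inj_aux {α : Type*} (H : α → α → α)
    (hH : ∀ a b c d : α, H a b = H c d → a = c ∧ b = d) :
    (l l' : List α) → l.length = l'.length → levelStep H l = levelStep H l' → l = l'
  | [], [], _, _ => rfl
  | [], _ :: _, hl, _ => by simp at hl
  | _ :: _, [], hl, _ => by simp at hl
  | [a], [b], _, h => by simpa [levelStep] using h
  | [_], _ :: _ :: _, hl, _ => by simp at hl
  | _ :: _ :: _, [_], hl, _ => by simp at hl
  | a :: b :: r, c :: d :: r', hl, h => by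
      simp only [levelStep, List.cons.injEq] at h
      obtain ⟨h1, h2⟩ := hH _ _ _ _ h.1
      have h3 := levelStep_inj_aux H hH r r' (by simpa using hl) h.2
      rw [h1, h2, h3]

theorem merkleRoot_inj_aux {α : Type*} (H : α → α → α)
    (hH : ∀ a b c d : α, H a b = H c d → a = c ∧ b = d) (n : ℕ) :
    ∀ l l' : List α, l.length = n → l'.length = n →
      merkleRoot? H l = merkleRoot? H l' → l = l' := by
  induction n using Nat.strong_induction_on with
  | _ n ih =>
    intro l l' hl hl' h
    match l, l' with
    | [], l' =>
      simp at hl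
      subst hl
      exact (List.length_eq_zero_iff.mp hl').symm
    | _ :: _, [] => simp at hl hl'; omega
    | [a], [b] => simpa [merkleRoot?] using h
    | [_], _ :: _ :: _ => simp at hl hl'; omega
    | _ :: _ :: _, [_] => simp at hl hl'; omega
    | a :: b :: r, c :: d :: r' =>
      rw [merkleRoot?, merkleRoot?] at h
      apply levelStep_inj_aux H hH _ _ (hl.trans hl'.symm)
      refine ih ((n + 1) / 2) ?_ _ _ ?_ ?_ h
      · simp at hl; omega
      · rw [levelStep_length, hl]
      · rw [levelStep_length, hl']

/-- **Integrity under modification (Theorem 2).** Let `hf : β → α` be an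
injective leaf-hash function and `H` a pairwise injective combiner. If the
nonempty logs `L` and `L'` have equal length and differ at some index `i`
(`L'[i] ≠ L[i]`), then the Merkle root of the leaf hashes of `L'` differs from
the Merkle root of the leaf hashes of `L`. -/
theorem merkleRoot_ne_of_modified {α β : Type*} (hf : β → α)
    (hfinj : Function.Injective hf) (H : α → α → α)
    (hH : ∀ a b c d : α, H a b = H c d → a = c ∧ b = d)
    (L L' : List β) (hne : L ≠ []) (hlen : L.length = L'.length)
    (i : ℕ) (hi : i < L.length)
    (hdiff : L'[i]'(hlen ▸ hi) ≠ L[i]) :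
    merkleRoot? H (L'.map hf) ≠ merkleRoot? H (L.map hf) := by
  intro h
  have h1 := merkleRoot_inj_aux H hH L.length _ _ (by simp [hlen]) (by simp) h
  have h2 : L' = L := hfinj.list_map h1
  subst h2
  exact hdiff rfl
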